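/- Decomposition of Sequence into Amongs hinders propagation in general, but for AtMostSeq it does not change the solution set: for 0/1 variables, Sequence(0,u,k,[X_1,…,X_n]) holds iff AtMost(u,[X_i,…,X_{i+k-1}]) holds for every 1 ≤ i ≤ n-k+1; moreover, given domains dom(X_i) ⊆ {0,1}, value v ∈ dom(X_j) has a support in AtMostSeq iff it has a support in every individual AtMost constraint whose window contains j (under the assumption that the minimal assignment satisfies each AtMost). -/

import Mathlib

/-- AtMost on the window `[i, i+k)`: at most `u` of the 0/1 variables
`x i, …, x (i+k-1)` equal 1. -/
def AtMostWin (u i k : ℕ) (x : ℕ → ℕ) : Prop :=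
  ∑ j ∈ Finset.Ico i (i + k), x j ≤ u

/-- AtMostSeq(u,k) = Sequence(0,u,k): every window of `k` consecutive
variables among `x 0, …, x (n-1)` contains at most `u` ones. -/
def AtMostSeq (n k u : ℕ) (x : ℕ → ℕ) : Prop :=
  ∀ i : ℕ, i + k ≤ n → AtMostWin u i k x

/-- Decomposing AtMostSeq into its individual AtMost constraints does
not change the solution set; moreover, provided the minimal assignment
satisfies every AtMost, a value `v ∈ dom j` has a support in AtMostSeq
iff it has a support in every individual AtMost whose window contains
`j`. -/
theorem stmt15 (n k u : ℕ) (hk : 1 ≤ k) (hkn : k ≤ n)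
    (dom : ℕ → Set ℕ)
    (hdom01 : ∀ i, dom i ⊆ {0, 1}) (hne : ∀ i, (dom i).Nonempty)
    (xmin : ℕ → ℕ)
    (hxmin0 : ∀ i, 0 ∈ dom i → xmin i = 0)
    (hxmin1 : ∀ i, 0 ∉ dom i → xmin i = 1)
    (hminsat : AtMostSeq n k u xmin) :
    (∀ x : ℕ → ℕ,
      (AtMostSeq n k u x ↔ ∀ i : ℕ, i + k ≤ n → AtMostWin u i k x)) ∧
    (∀ j v, j < n → v ∈ dom j →
      ((∃ x : ℕ → ℕ, (∀ i, i < n → x i ∈ dom i) ∧ x j = v ∧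
          AtMostSeq n k u x) ↔
        (∀ i : ℕ, i + k ≤ n → i ≤ j → j < i + k →
          ∃ x : ℕ → ℕ, (∀ t, t < n → x t ∈ dom t) ∧ x j = v ∧
            AtMostWin u i k x))) := by
  have hmem : ∀ i, xmin i ∈ dom i := by
    intro i
    by_cases h : 0 ∈ dom i
    · rw [hxmin0 i h]; exact h
    · rw [hxmin1 i h]
      obtain ⟨a, ha⟩ := hne i
      rcases hdom01 i ha with h0 | h1
      · rw [h0] at ha; exact absurd ha h
      · rw [Set.mem_singleton_iff] at h1
        rw [h1] at ha; exact ha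
  have hle : ∀ i a, a ∈ dom i → xmin i ≤ a := by
    intro i a ha
    by_cases h : 0 ∈ dom i
    · rw [hxmin0 i h]; exact Nat.zero_le _
    · rw [hxmin1 i h]
      rcases Nat.eq_zero_or_pos a with h0 | h0
      · rw [h0] at ha; exact absurd ha h
      · exact h0
  refine ⟨fun x => Iff.rfl, fun j v hj hv => ⟨?_, ?_⟩⟩
  · rintro ⟨x, hx, hxj, hs⟩ i hi _ _
    exact ⟨x, hx, hxj, hs i hi⟩
  · intro H
    refine ⟨Function.update xmin j v, ?_, by simp, ?_⟩
    · intro i _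
      by_cases h : i = j
      · subst h; simpa using hv
      · simpa [h] using hmem i
    · intro i hi
      by_cases hw : i ≤ j ∧ j < i + k
      · obtain ⟨x, hx, hxj, hs⟩ := H i hi hw.1 hw.2
        refine le_trans (Finset.sum_le_sum ?_) hs
        intro t ht
        rw [Finset.mem_Ico] at ht
        by_cases h : t = j
        · subst h; simp [hxj]
        · simpa [h] using hle t (x t) (hx t (by omega))
      · refine le_trans (Finset.sum_le_sum ?_) (hminsat i hi)
        intro t ht
        rw [Finset.mem_Ico] at ht
        have h : t ≠ j := by rintro rfl; exact hw ht
        simp [h]
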